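/- Under Hypothesis H, the zeta integral 𝒵_{N,n}(s,w,M) := ∫_{t ∈ (0,∞)^N} Π_{j=1}^n (w_j + t_1 a_{1j} + ⋯ + t_N a_{Nj})^{−s} dt converges absolutely whenever Re(s) > N/(n − Z_M) and Re(w_j) > 0 for all j, the convergence being uniform on compact subsets of {s : Re(s) > N/(n − Z_M)} × {w ∈ ℂ^n : Re(w_j) > 0 for 1 ≤ j ≤ n}, and the function (s,w) ↦ 𝒵_{N,n}(s,w,M) is analytic on this domain. -/

import Mathlib

open MeasureTheory Complex
open scoped Classical

noncomputable section

/-- Hypothesis H: each entry of the matrix either vanishes or has positive real part,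
and no row vanishes. -/
def HypH {N n : ℕ} (a : Fin N → Fin n → ℂ) : Prop :=
  (∀ i j, a i j = 0 ∨ 0 < (a i j).re) ∧ ∀ i, ∃ j, a i j ≠ 0

/-- `Z_M`: the maximal number of vanishing entries in a row. -/
def ZM {N n : ℕ} (a : Fin N → Fin n → ℂ) : ℕ :=
  Finset.univ.sup fun i => (Finset.univ.filter fun j => a i j = 0).card

/-- The Shintani–Barnes zeta integral `𝒵_{N,n}(s,w,M)`. -/
def zetaIntegral {N n : ℕ} (a : Fin N → Fin n → ℂ) (s : ℂ) (w : Fin n → ℂ) : ℂ :=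
  ∫ t in {t : Fin N → ℝ | ∀ i, 0 < t i}, ∏ j, (w j + ∑ i, (t i : ℂ) * a i j) ^ (-s)

/-- A continuous map from a closed disc to `C(K, F)` all of whose evaluations are holomorphic
is itself analytic at the centre. -/
theorem analyticAt_continuousMap_of_apply {K F : Type*} [TopologicalSpace K] [CompactSpace K]
    [NormedAddCommGroup F] [NormedSpace ℂ F] [CompleteSpace F] {g : ℂ → C(K, F)} {c : ℂ} {R : ℝ}
    (hR : 0 < R) (hc : ContinuousOn g (Metric.closedBall c R))
    (hd : ∀ k, DifferentiableOn ℂ (fun z => g z k) (Metric.closedBall c R)) :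
    AnalyticAt ℂ g c := by
  lift R to NNReal using hR.le
  have hR' : (0 : NNReal) < R := by exact_mod_cast hR
  have hs : ContinuousOn g (Metric.sphere c R) := hc.mono Metric.sphere_subset_closedBall
  have h := (hasFPowerSeriesOn_cauchy_integral (hs.circleIntegrable R.2) hR').analyticAt
  refine h.congr ?_
  filter_upwards [Metric.ball_mem_nhds c hR] with w hw
  ext k
  have h1 := DiffContOnCl.two_pi_i_inv_smul_circleIntegral_sub_inv_smul
    ((hd k).diffContOnCl_ball subset_rfl) hw
  rw [← h1, ContinuousMap.smul_apply]
  congr 1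
  have hci : CircleIntegrable (fun z => (z - w)⁻¹ • g z) c R := by
    refine ContinuousOn.circleIntegrable R.2 (ContinuousOn.smul 
      (ContinuousOn.inv₀ (continuousOn_id.sub continuousOn_const) ?_) hs)
    intro z hz h0
    obtain rfl : z = w := sub_eq_zero.1 h0
    simp only [Metric.mem_sphere, Metric.mem_ball] at hz hw
    exact hw.ne hz
  have h2 := (ContinuousMap.evalCLM ℂ k : C(K, F) →L[ℂ] F).intervalIntegral_comp_comm
    ((circleIntegrable_iff _).1 hci)
  rw [circleIntegral, circleIntegral]
  simpa using h2.symm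

/-- The circle integral as a continuous linear map on continuous functions on the circle. -/
def circleIntegralCLM (F : Type*) [NormedAddCommGroup F] [NormedSpace ℂ F] (c : ℂ) (R : NNReal) :
    C(Metric.sphere c (R : ℝ), F) →L[ℂ] F :=
  LinearMap.mkContinuous
    { toFun := fun g => ∫ θ in (0 : ℝ)..2 * Real.pi, deriv (circleMap c R) θ •
        g ⟨circleMap c R θ, circleMap_mem_sphere c R.2 θ⟩
      map_add' := by
        intro g h
        simp only [ContinuousMap.add_apply, smul_add]
        refine intervalIntegral.integral_add ?_ ?_ <;>
        · refine Continuous.intervalIntegrable ?_ _ _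
          simp only [deriv_circleMap]
          fun_prop
      map_smul' := by
        intro a g
        simp only [ContinuousMap.smul_apply, RingHom.id_apply]
        rw [← intervalIntegral.integral_smul]
        simp only [smul_comm a] }
    (R * (2 * Real.pi)) (by
      intro g
      have := intervalIntegral.norm_integral_le_of_norm_le_const (a := 0) (b := 2 * Real.pi)
        (C := R * ‖g‖) (f := fun θ => deriv (circleMap c R) θ •
        g ⟨circleMap c R θ, circleMap_mem_sphere c R.2 θ⟩) (by
          intro θ _
          rw [norm_smul]
          refine mul_le_mul ?_ (g.norm_coe_le_norm _) (norm_nonneg _) R.2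
          simp [deriv_circleMap])
      simp only [sub_zero, abs_of_pos Real.two_pi_pos] at this
      simp only [LinearMap.coe_mk, AddHom.coe_mk]
      linarith)

theorem circleIntegralCLM_apply {F : Type*} [NormedAddCommGroup F] [NormedSpace ℂ F] (c : ℂ)
    (R : NNReal) (g : C(Metric.sphere c (R : ℝ), F)) (f : ℂ → F) (h : ∀ ζ, g ζ = f ζ) :
    circleIntegralCLM F c R g = ∮ z in C(c, R), f z := by
  simp [circleIntegralCLM, circleIntegral, h]

theorem Fin.cons_mem_closedBall {m : ℕ} {c : Fin (m + 1) → ℂ} {R : ℝ} (hR : 0 ≤ R) {z : ℂ}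
    {y : Fin m → ℂ} (hz : z ∈ Metric.closedBall (c 0) R)
    (hy : y ∈ Metric.closedBall (Fin.tail c) R) :
    (Fin.cons z y : Fin (m + 1) → ℂ) ∈ Metric.closedBall c R := by
  rw [Metric.mem_closedBall, dist_pi_le_iff hR] at *
  intro i
  refine Fin.cases ?_ (fun j => ?_) i
  · simpa using hz
  · simpa [Fin.tail] using hy j

theorem update_mem_closedBall {m : ℕ} {c y : Fin m → ℂ} {r R : ℝ} (hr : 0 ≤ r) (hrR : r ≤ R)
    (hy : y ∈ Metric.closedBall c (R - r)) {i : Fin m} {z : ℂ}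
    (hz : z ∈ Metric.closedBall (y i) r) :
    Function.update y i z ∈ Metric.closedBall c R := by
  rw [Metric.mem_closedBall, dist_pi_le_iff (by linarith)] at *
  intro j
  rcases eq_or_ne j i with rfl | hj
  · have := dist_triangle z (y j) (c j)
    have := hy j
    simp only [Function.update_self]
    linarith
  · simp only [Function.update_of_ne hj]
    linarith [hy j]

theorem exists_continuousOn_curry {X K F : Type*} [TopologicalSpace X] [TopologicalSpace K]
    [TopologicalSpace F] [Zero F] {B : Set X} {φ : X → K → F}
    (h : Continuous fun p : B × K => φ p.1 p.2) :
    ∃ G : X → C(K, F), ContinuousOn G B ∧ ∀ y ∈ B, ∀ k, G y k = φ y k := by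
  let Gc : C(B, C(K, F)) := ContinuousMap.curry ⟨_, h⟩
  refine ⟨fun y => if hy : y ∈ B then Gc ⟨y, hy⟩ else 0, ?_, fun y hy k => by simp [hy, Gc]⟩
  rw [continuousOn_iff_continuous_domRestrict]
  convert Gc.continuous using 1
  ext y : 1
  simp

/-- **Osgood's lemma**: a continuous, separately holomorphic function of several complex variables
is analytic. The induction on the number of variables writes `f (z, y)` as the Cauchy integral of
`ζ ↦ f (ζ, y)`, viewed as a function of `y` with values in continuous functions on a circle. -/
theorem analyticAt_of_separately_differentiable {m : ℕ} {A : Type*} [NormedCommRing A]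
    [NormedAlgebra ℂ A] [CompleteSpace A] {f : (Fin m → ℂ) → A} {c : Fin m → ℂ} {R : ℝ}
    (hR : 0 < R) (hc : ContinuousOn f (Metric.closedBall c R))
    (hd : ∀ x ∈ Metric.closedBall c R, ∀ i,
      DifferentiableAt ℂ (fun z => f (Function.update x i z)) (x i)) :
    AnalyticAt ℂ f c := by
  induction m generalizing A R with
  | zero =>
    have : f = fun _ => f c := funext fun x => congrArg f (Subsingleton.elim _ _)
    rw [this]
    exact analyticAt_const
  | succ m ih =>
    lift R to NNReal using hR.le
    set S := Metric.sphere (c 0) (R : ℝ)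
    set B := Metric.closedBall (Fin.tail c) (R : ℝ)
    have hSB : ∀ ζ ∈ S, ∀ y ∈ B, (Fin.cons ζ y : Fin (m + 1) → ℂ) ∈ Metric.closedBall c R :=
      fun ζ hζ y hy => Fin.cons_mem_closedBall R.2 (Metric.sphere_subset_closedBall hζ) hy
    have hcurry : Continuous fun p : B × S => f (Fin.cons p.2.1 p.1.1) := by
      refine hc.comp_continuous (by fun_prop) fun p => hSB _ p.2.2 _ p.1.2
    obtain ⟨G, hGc, hG⟩ := exists_continuousOn_curry
      (φ := fun y (ζ : S) => f (Fin.cons ζ.1 y)) hcurry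
    have hR2 : (0 : ℝ) < R / 2 := by linarith
    have hGa : AnalyticAt ℂ G (Fin.tail c) := by
      refine ih (R := R / 2) hR2
        (hGc.mono (Metric.closedBall_subset_closedBall (by linarith))) fun y hy i => ?_
      have hu : ∀ z ∈ Metric.closedBall (y i) (R / 2 : ℝ), Function.update y i z ∈ B :=
        fun z hz => update_mem_closedBall hR2.le (by linarith)
          (by convert hy using 2; ring) hz
      refine (analyticAt_continuousMap_of_apply hR2 (g := fun z => G (Function.update y i z))
        (hGc.comp (by fun_prop) hu) fun ζ => ?_).differentiableAt
      intro z hz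
      have h1 := hd _ (hSB ζ.1 ζ.2 _ (hu z hz)) i.succ
      simp only [Fin.cons_succ, Function.update_self, ← Fin.cons_update,
        Function.update_idem] at h1
      refine h1.differentiableWithinAt.congr (fun w hw => hG _ (hu w hw) ζ) (hG _ (hu z hz) ζ)
    set D := Metric.closedBall (c 0) (R / 2 : ℝ)
    have hne : ∀ z ∈ D, ∀ ζ ∈ S, ζ - z ≠ 0 := by
      intro z hz ζ hζ h0
      rw [sub_eq_zero] at h0
      subst h0
      have h1 := Metric.mem_closedBall.1 hz
      have h2 := Metric.mem_sphere.1 hζ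
      linarith
    have hκcont : Continuous fun p : D × S => algebraMap ℂ A (p.2.1 - p.1.1)⁻¹ :=
      (algebraMapCLM ℂ A).continuous.comp
        (Continuous.inv₀ (by fun_prop) fun p => hne _ p.1.2 _ p.2.2)
    obtain ⟨κ, hκc, hκ⟩ := exists_continuousOn_curry
      (φ := fun z (ζ : S) => algebraMap ℂ A (ζ.1 - z)⁻¹) hκcont
    have hκa : AnalyticAt ℂ κ (c 0) := by
      refine analyticAt_continuousMap_of_apply hR2 hκc fun ζ => ?_
      refine DifferentiableOn.congr ?_ fun z hz => hκ z hz ζ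
      refine (algebraMapCLM ℂ A).differentiable.comp_differentiableOn
        (DifferentiableOn.inv (by fun_prop) fun z hz => hne z hz _ ζ.2)
    have hprod : AnalyticAt ℂ (fun x : Fin (m + 1) → ℂ => κ (x 0) * G (Fin.tail x)) c := by
      refine AnalyticAt.mul ?_ ?_
      · exact hκa.comp_of_eq
          ((ContinuousLinearMap.proj (R := ℂ) (φ := fun _ : Fin (m + 1) => ℂ) 0).analyticAt c) rfl
      · exact hGa.comp_of_eq
          ((ContinuousLinearMap.pi fun i : Fin m =>
            ContinuousLinearMap.proj (R := ℂ) (φ := fun _ : Fin (m + 1) => ℂ) i.succ).analyticAt c)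
          rfl
    have hint := (((circleIntegralCLM A (c 0) R).analyticAt _).comp hprod).const_smul
      (c := (2 * Real.pi * I : ℂ)⁻¹)
    refine hint.congr ?_
    filter_upwards [Metric.ball_mem_nhds c hR2] with x hx
    have hx' : ∀ i, dist (x i) (c i) < R / 2 := fun i =>
      (dist_le_pi_dist x c i).trans_lt (Metric.mem_ball.1 hx)
    have hxB : Fin.tail x ∈ B := by
      refine Metric.mem_closedBall.2 ((dist_pi_le_iff R.2).2 fun i => ?_)
      exact (hx' i.succ).le.trans (half_le_self hR.le)
    have hxD : x 0 ∈ D := Metric.mem_closedBall.2 (hx' 0).le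
    simp only [Pi.smul_apply, Function.comp]
    rw [circleIntegralCLM_apply _ _ _
      (fun ζ => (ζ - x 0)⁻¹ • f (Fin.cons ζ (Fin.tail x)))]
    · rw [DiffContOnCl.two_pi_i_inv_smul_circleIntegral_sub_inv_smul
        (f := fun ζ => f (Fin.cons ζ (Fin.tail x)))
        (DifferentiableOn.diffContOnCl_ball (fun z hz => ?_) subset_rfl)]
      · simp
      · rw [Metric.mem_ball]
        linarith [hx' 0]
      · have h1 := hd _ (Fin.cons_mem_closedBall R.2 hz hxB) 0
        simp only [Fin.cons_zero, Fin.update_cons_zero] at h1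
        exact h1.differentiableWithinAt
    · intro ζ
      rw [ContinuousMap.mul_apply, hκ _ hxD, hG _ hxB, Algebra.smul_def]

theorem positiveOrthant_eq_pi (N : ℕ) :
    {t : Fin N → ℝ | ∀ i, 0 < t i} = Set.univ.pi fun _ => Set.Ioi 0 := by
  ext t
  simp

theorem measurableSet_positiveOrthant (N : ℕ) :
    MeasurableSet {t : Fin N → ℝ | ∀ i, 0 < t i} := by
  rw [positiveOrthant_eq_pi]
  exact MeasurableSet.univ_pi fun _ => measurableSet_Ioi

theorem integrableOn_prod_one_add_rpow {N : ℕ} {p : ℝ} (hp : 1 < p) :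
    IntegrableOn (fun t : Fin N → ℝ => ∏ i, (t i + 1) ^ (-p))
      {t : Fin N → ℝ | ∀ i, 0 < t i} volume := by
  rw [positiveOrthant_eq_pi, IntegrableOn, volume_pi, Measure.restrict_pi_pi]
  exact Integrable.fintype_prod (f := fun _ x => (x + 1) ^ (-p))
    fun _ => integrableOn_add_rpow_Ioi_of_lt (by linarith) (by norm_num)

theorem prod_rpow_neg_le_prod_pow {ι κ : Type*} [Fintype ι] [Fintype κ] [Nonempty ι]
    (P : ι → κ → Prop) [∀ i, DecidablePred (P i)] {d : ℕ} (hd : ∀ i, d ≤ (Finset.univ.filter fun j => P i j).card)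
    {x : ι → ℝ} {L : κ → ℝ} (hx : ∀ i, 1 ≤ x i) (hL : ∀ j, 1 ≤ L j)
    (hxL : ∀ i j, P i j → x i ≤ L j) {σ : ℝ} (hσ : 0 ≤ σ) :
    ∏ j, L j ^ (-σ) ≤ ∏ i, x i ^ (-(σ / Fintype.card ι * d)) := by
  set e := σ / Fintype.card ι with he
  have hcard : (0 : ℝ) < Fintype.card ι := by exact_mod_cast Fintype.card_pos
  have he0 : 0 ≤ e := by positivity
  have h1 : ∀ j, L j ^ (-σ) = ∏ _i : ι, L j ^ (-e) := by
    intro j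
    rw [Finset.prod_const, ← Real.rpow_natCast, ← Real.rpow_mul (by linarith [hL j]),
      Finset.card_univ, he]
    congr 1
    field_simp
  simp only [h1]
  rw [Finset.prod_comm]
  refine Finset.prod_le_prod (fun i _ => Finset.prod_nonneg fun j _ =>
    Real.rpow_nonneg (by linarith [hL j]) _) fun i _ => ?_
  have hx0 : 0 ≤ x i := by linarith [hx i]
  calc ∏ j, L j ^ (-e) ≤ ∏ j, if P i j then x i ^ (-e) else 1 := by
        refine Finset.prod_le_prod (fun j _ => Real.rpow_nonneg (by linarith [hL j]) _)
          fun j _ => ?_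
        split_ifs with h
        · exact Real.rpow_le_rpow_of_nonpos (by linarith [hx i]) (hxL i j h) (by linarith)
        · exact Real.rpow_le_one_of_one_le_of_nonpos (hL j) (by linarith)
    _ = (x i ^ (-e)) ^ (Finset.univ.filter fun j => P i j).card := by
        rw [← Finset.prod_filter, Finset.prod_const]
    _ ≤ (x i ^ (-e)) ^ d := pow_le_pow_of_le_one (Real.rpow_nonneg hx0 _)
        (Real.rpow_le_one_of_one_le_of_nonpos (hx i) (by linarith)) (hd i)
    _ = x i ^ (-(e * d)) := by
        rw [← Real.rpow_natCast, ← Real.rpow_mul hx0, neg_mul]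

theorem norm_cpow_neg_le {z s : ℂ} {c L σ₀ σ₁ T : ℝ} (hc : 0 < c) (hc1 : c ≤ 1) (hL : 1 ≤ L)
    (hz : c * L ≤ z.re) (h0 : 0 ≤ σ₀) (h₀ : σ₀ ≤ s.re) (h₁ : s.re ≤ σ₁) (hT : |s.im| ≤ T) :
    ‖z ^ (-s)‖ ≤ c ^ (-σ₁) * Real.exp (Real.pi * T) * L ^ (-σ₀) := by
  have hzn : c * L ≤ ‖z‖ := hz.trans ((le_abs_self _).trans (abs_re_le_norm z))
  have hcL : 0 < c * L := by positivity
  refine (norm_cpow_le z (-s)).trans ?_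
  rw [div_eq_mul_inv, ← Real.exp_neg, neg_re, neg_im]
  have hA : ‖z‖ ^ (-s.re) ≤ c ^ (-σ₁) * L ^ (-σ₀) := by
    calc ‖z‖ ^ (-s.re) ≤ (c * L) ^ (-s.re) :=
          Real.rpow_le_rpow_of_nonpos hcL hzn (by linarith)
      _ = c ^ (-s.re) * L ^ (-s.re) := Real.mul_rpow hc.le (by linarith)
      _ ≤ c ^ (-σ₁) * L ^ (-σ₀) := by
          gcongr ?_ * ?_
          · exact Real.rpow_le_rpow_of_exponent_ge hc hc1 (by linarith)
          · exact Real.rpow_le_rpow_of_exponent_le hL (by linarith)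
  have hB : Real.exp (-(arg z * -s.im)) ≤ Real.exp (Real.pi * T) := by
    refine Real.exp_le_exp.2 ?_
    calc -(arg z * -s.im) = arg z * s.im := by ring
      _ ≤ |arg z * s.im| := le_abs_self _
      _ = |arg z| * |s.im| := abs_mul _ _
      _ ≤ Real.pi * T := mul_le_mul (abs_arg_le_pi z) hT (abs_nonneg _) Real.pi_pos.le
  calc _ ≤ (c ^ (-σ₁) * L ^ (-σ₀)) * Real.exp (Real.pi * T) :=
        mul_le_mul hA hB (Real.exp_pos _).le (by positivity)
    _ = _ := by ring

theorem differentiableAt_integral_of_dominated {α : Type*} [MeasurableSpace α] {μ : Measure α}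
    {F : ℂ → α → ℂ} {b : α → ℝ} {c : ℂ} {R : ℝ} (hR : 0 < R)
    (hm : ∀ z ∈ Metric.closedBall c R, AEStronglyMeasurable (F z) μ)
    (hd : ∀ᵐ t ∂μ, DifferentiableOn ℂ (fun z => F z t) (Metric.closedBall c R))
    (hb : ∀ᵐ t ∂μ, ∀ z ∈ Metric.closedBall c R, ‖F z t‖ ≤ b t) (hbi : Integrable b μ) :
    DifferentiableAt ℂ (fun z => ∫ t, F z t ∂μ) c := by
  have hR2 : 0 < R / 2 := by linarith
  have hc : c ∈ Metric.closedBall c R := Metric.mem_closedBall_self hR.le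
  have hnhds := Metric.closedBall_mem_nhds c hR
  have hderiv : ∀ᵐ t ∂μ, ∀ z ∈ Metric.ball c (R / 2),
      HasDerivAt (fun z => F z t) (deriv (fun z => F z t) z) z := by
    filter_upwards [hd] with t ht z hz
    refine (ht.differentiableAt (Filter.mem_of_superset (Metric.isOpen_ball.mem_nhds hz)
      ((Metric.ball_subset_closedBall).trans
        (Metric.closedBall_subset_closedBall (by linarith))))).hasDerivAt
  refine (hasDerivAt_integral_of_dominated_loc_of_deriv_le (s := Metric.ball c (R / 2))
    (F' := fun z t => deriv (fun z => F z t) z) (bound := fun t => b t / (R / 2))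
    (Metric.ball_mem_nhds c hR2) (Filter.mem_of_superset hnhds hm)
    ?_ ?_ ?_ (hbi.div_const _) hderiv).2.differentiableAt
  · refine hbi.mono' (hm c hc) (hb.mono fun t ht => ht c hc)
  · let u : ℕ → ℂ := fun k => ((R / (k + 1) : ℝ) : ℂ)
    have hu0 : Filter.Tendsto u Filter.atTop (nhds 0) := by
      have h := (tendsto_one_div_add_atTop_nhds_zero_nat (𝕜 := ℝ)).const_mul R
      simp only [mul_one_div, mul_zero] at h
      simpa [u, Function.comp_def] using (continuous_ofReal.tendsto 0).comp h
    have hune : ∀ k, u k ≠ 0 := by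
      intro k
      simp only [u, ne_eq, ofReal_eq_zero]
      positivity
    have hmem : ∀ k, c + u k ∈ Metric.closedBall c R := by
      intro k
      simp only [Metric.mem_closedBall, dist_self_add_left, u, norm_real, Real.norm_eq_abs]
      rw [abs_of_pos (by positivity)]
      exact div_le_self hR.le (by linarith [(Nat.cast_nonneg k : (0 : ℝ) ≤ k)])
    refine aestronglyMeasurable_of_tendsto_ae (u := Filter.atTop)
      (f := fun k t => (u k)⁻¹ • (F (c + u k) t - F c t))
      (fun k => ((hm _ (hmem k)).sub (hm c hc)).const_smul (u k)⁻¹) ?_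
    filter_upwards [hderiv] with t ht
    exact ((hasDerivAt_iff_tendsto_slope_zero.1 (ht c (Metric.mem_ball_self hR2)))).comp
      (tendsto_nhdsWithin_iff.2 ⟨hu0, Filter.Eventually.of_forall hune⟩)
  · filter_upwards [hd, hb] with t ht hbt z hz
    have hsub : Metric.closedBall z (R / 2) ⊆ Metric.closedBall c R :=
      Metric.closedBall_subset_closedBall' (by linarith [Metric.mem_ball.1 hz])
    exact norm_deriv_le_of_forall_mem_sphere_norm_le hR2
      ((ht.mono hsub).diffContOnCl_ball subset_rfl)
      fun w hw => hbt w (hsub (Metric.sphere_subset_closedBall hw))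

theorem ZM_lt {N n : ℕ} (hn : 0 < n) {a : Fin N → Fin n → ℂ} (hH : HypH a) : ZM a < n := by
  refine (Finset.sup_lt_iff (by simpa using hn)).2 fun i _ => ?_
  obtain ⟨j, hj⟩ := hH.2 i
  have : (Finset.univ.filter fun j => a i j = 0).card < (Finset.univ : Finset (Fin n)).card :=
    Finset.card_lt_card (Finset.filter_ssubset.2 ⟨j, Finset.mem_univ j, hj⟩)
  simpa using this

theorem sub_ZM_le_card {N n : ℕ} (a : Fin N → Fin n → ℂ) (i : Fin N) :
    n - ZM a ≤ (Finset.univ.filter fun j => a i j ≠ 0).card := by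
  have h1 : (Finset.univ.filter fun j => a i j = 0).card ≤ ZM a :=
    Finset.le_sup (f := fun i => (Finset.univ.filter fun j => a i j = 0).card) (Finset.mem_univ i)
  have h2 := Finset.card_filter_add_card_filter_not (s := (Finset.univ : Finset (Fin n)))
    (fun j => a i j = 0)
  simp only [Finset.card_univ, Fintype.card_fin] at h2
  simp only [ne_eq]
  omega

theorem le_re_linearForm {N n : ℕ} {a : Fin N → Fin n → ℂ} {w : ℂ} {c : ℝ} {j : Fin n}
    {t : Fin N → ℝ} (ht : ∀ i, 0 < t i) (hw : c ≤ w.re) (ha : ∀ i, a i j ≠ 0 → c ≤ (a i j).re) :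
    c * (1 + ∑ i, if a i j ≠ 0 then t i else 0) ≤ (w + ∑ i, (t i : ℂ) * a i j).re := by
  rw [mul_add, mul_one, Finset.mul_sum, add_re, re_sum]
  refine add_le_add hw (Finset.sum_le_sum fun i _ => ?_)
  split_ifs with h
  · rw [re_ofReal_mul, mul_comm]
    exact mul_le_mul_of_nonneg_left (ha i h) (ht i).le
  · simp [not_not.1 h]

theorem linearForm_mem_slitPlane {N n : ℕ} {a : Fin N → Fin n → ℂ} (hH : HypH a) {w : ℂ}
    (hw : 0 < w.re) (j : Fin n) {t : Fin N → ℝ} (ht : ∀ i, 0 < t i) :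
    w + ∑ i, (t i : ℂ) * a i j ∈ slitPlane := by
  refine Or.inl ?_
  rw [add_re, re_sum]
  refine add_pos_of_pos_of_nonneg hw (Finset.sum_nonneg fun i _ => ?_)
  rw [re_ofReal_mul]
  rcases hH.1 i j with h | h
  · simp [h]
  · exact (mul_pos (ht i) h).le

theorem aestronglyMeasurable_zetaIntegrand {N n : ℕ} {a : Fin N → Fin n → ℂ} (hH : HypH a)
    (s : ℂ) {w : Fin n → ℂ} (hw : ∀ j, 0 < (w j).re) :
    AEStronglyMeasurable (fun t : Fin N → ℝ => ∏ j, (w j + ∑ i, (t i : ℂ) * a i j) ^ (-s))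
      (volume.restrict {t : Fin N → ℝ | ∀ i, 0 < t i}) := by
  refine ContinuousOn.aestronglyMeasurable ?_ (measurableSet_positiveOrthant N)
  refine continuousOn_finsetProd _ fun j _ => ?_
  exact ContinuousOn.cpow_const (by fun_prop) fun t ht => linearForm_mem_slitPlane hH (hw j) j ht

theorem exists_integrable_bound_zetaIntegrand {N n : ℕ} (hN : 0 < N) (hn : 0 < n)
    {a : Fin N → Fin n → ℂ} (hH : HypH a) {K : Set (ℂ × (Fin n → ℂ))} (hK : IsCompact K)
    (hsub : K ⊆ {p | (N : ℝ) / ((n : ℝ) - (ZM a : ℝ)) < p.1.re ∧ ∀ j, 0 < (p.2 j).re}) :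
    ∃ b : (Fin N → ℝ) → ℝ, IntegrableOn b {t : Fin N → ℝ | ∀ i, 0 < t i} volume ∧
      ∀ p ∈ K, ∀ t ∈ {t : Fin N → ℝ | ∀ i, 0 < t i},
        ‖∏ j, (p.2 j + ∑ i, (t i : ℂ) * a i j) ^ (-p.1)‖ ≤ b t := by
  have : Nonempty (Fin N) := ⟨⟨0, hN⟩⟩
  have hZ : ZM a < n := ZM_lt hn hH
  have hd : ((n - ZM a : ℕ) : ℝ) = (n : ℝ) - ZM a := Nat.cast_sub hZ.le
  have hd0 : 0 < (n : ℝ) - ZM a := sub_pos.2 (by exact_mod_cast hZ)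
  have hN0 : (0 : ℝ) < N := by exact_mod_cast hN
  obtain ⟨σ₀, hσ₀, hσ₀K⟩ := hK.exists_forall_le' (f := fun p => p.1.re)
    (by fun_prop) fun p hp => (hsub hp).1
  obtain ⟨σ₁, hσ₁⟩ := (hK.image_of_continuousOn (f := fun p => p.1.re) (by fun_prop)).bddAbove
  obtain ⟨T, hT⟩ := (hK.image_of_continuousOn (f := fun p => |p.1.im|)
    (by fun_prop)).bddAbove
  have hcw : ∀ᶠ c : ℝ in nhdsWithin 0 (Set.Ioi 0), ∀ j, ∀ p ∈ K, c ≤ (p.2 j).re := by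
    refine Filter.eventually_all.2 fun j => ?_
    obtain ⟨c, hc, hcK⟩ := hK.exists_forall_le' (f := fun p => (p.2 j).re)
      (by fun_prop) fun p hp => (hsub hp).2 j
    filter_upwards [Ioc_mem_nhdsGT hc] with c' hc' p hp
    exact hc'.2.trans (hcK p hp)
  have hca : ∀ᶠ c : ℝ in nhdsWithin 0 (Set.Ioi 0), ∀ i j, a i j ≠ 0 → c ≤ (a i j).re := by
    refine Filter.eventually_all.2 fun i => Filter.eventually_all.2 fun j => ?_
    rcases hH.1 i j with h | h
    · simp [h]
    · filter_upwards [Ioc_mem_nhdsGT h] with c' hc' _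
      exact hc'.2
  obtain ⟨c, hcw, hca, hc0, hc1⟩ :=
    (hcw.and (hca.and (Ioc_mem_nhdsGT (zero_lt_one' ℝ)))).exists
  have hσ₀0 : 0 ≤ σ₀ := (div_pos hN0 hd0).le.trans hσ₀.le
  have hp : 1 < σ₀ / Fintype.card (Fin N) * (n - ZM a : ℕ) := by
    rw [hd, Fintype.card_fin, div_mul_eq_mul_div, one_lt_div hN0]
    exact (div_lt_iff₀ hd0).1 hσ₀
  refine ⟨fun t => (∏ _j : Fin n, c ^ (-σ₁) * Real.exp (Real.pi * T)) *
    ∏ i, (t i + 1) ^ (-(σ₀ / Fintype.card (Fin N) * (n - ZM a : ℕ))),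
    (integrableOn_prod_one_add_rpow hp).const_mul _, fun p hpK t ht => ?_⟩
  have hL0 : ∀ j i, 0 ≤ if a i j ≠ 0 then t i else 0 := by
    intro j i
    split_ifs
    exacts [(ht i).le, le_rfl]
  have hL : ∀ j, 1 ≤ 1 + ∑ i, if a i j ≠ 0 then t i else 0 := fun j =>
    le_add_of_nonneg_right (Finset.sum_nonneg fun i _ => hL0 j i)
  rw [norm_prod]
  calc _ ≤ ∏ j, (c ^ (-σ₁) * Real.exp (Real.pi * T)) *
        (1 + ∑ i, if a i j ≠ 0 then t i else 0) ^ (-σ₀) :=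
        Finset.prod_le_prod (fun _ _ => norm_nonneg _) fun j _ =>
          norm_cpow_neg_le hc0 hc1 (hL j)
            (le_re_linearForm ht (hcw j p hpK) fun i => hca i j) hσ₀0 (hσ₀K p hpK)
            (hσ₁ ⟨p, hpK, rfl⟩) (hT ⟨p, hpK, rfl⟩)
    _ ≤ _ := by
      rw [Finset.prod_mul_distrib]
      refine mul_le_mul_of_nonneg_left ?_ (Finset.prod_nonneg fun _ _ => by positivity)
      refine prod_rpow_neg_le_prod_pow (fun i j => a i j ≠ 0) (sub_ZM_le_card a)
        (fun i => by linarith [ht i]) hL (fun i j hij => ?_) hσ₀0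
      have := Finset.single_le_sum (fun i _ => hL0 j i) (Finset.mem_univ i)
      rw [if_pos hij] at this
      linarith

theorem analyticAt_zetaIntegral {N n : ℕ} (hN : 0 < N) (hn : 0 < n)
    {a : Fin N → Fin n → ℂ} (hH : HypH a) {p : ℂ × (Fin n → ℂ)}
    (hp : (N : ℝ) / ((n : ℝ) - (ZM a : ℝ)) < p.1.re ∧ ∀ j, 0 < (p.2 j).re) :
    AnalyticAt ℂ (fun p : ℂ × (Fin n → ℂ) => zetaIntegral a p.1 p.2) p := by
  let c : Fin (n + 1) → ℂ := Fin.cons p.1 p.2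
  let V : Set (Fin (n + 1) → ℂ) :=
    {x | (N : ℝ) / ((n : ℝ) - (ZM a : ℝ)) < (x 0).re ∧ ∀ j : Fin n, 0 < (x j.succ).re}
  let μ : Measure (Fin N → ℝ) := volume.restrict {t : Fin N → ℝ | ∀ i, 0 < t i}
  let Φ : (Fin (n + 1) → ℂ) → (Fin N → ℝ) → ℂ := fun x t =>
    ∏ j : Fin n, (x j.succ + ∑ i, (t i : ℂ) * a i j) ^ (-x 0)
  have hpos : ∀ᵐ t ∂μ, ∀ i, 0 < t i := ae_restrict_mem (measurableSet_positiveOrthant N)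
  have hVo : IsOpen V := by
    have : V = {x | (N : ℝ) / ((n : ℝ) - (ZM a : ℝ)) < (x 0).re} ∩
        ⋂ j : Fin n, {x | 0 < (x j.succ).re} := by
      ext x
      simp [V]
    rw [this]
    exact (isOpen_lt (by fun_prop) (by fun_prop)).inter
      (isOpen_iInter_of_finite fun j => isOpen_lt (by fun_prop) (by fun_prop))
  have hcV : c ∈ V := by simpa [c, V] using hp
  obtain ⟨R, hR, hRV⟩ := Metric.nhds_basis_closedBall.mem_iff.1 (hVo.mem_nhds hcV)
  obtain ⟨b, hbi, hb⟩ := exists_integrable_bound_zetaIntegrand hN hn hH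
    ((isCompact_closedBall c R).image
      (f := fun x : Fin (n + 1) → ℂ => (x 0, fun j : Fin n => x j.succ)) (by fun_prop)) (by
      rintro _ ⟨x, hx, rfl⟩
      exact hRV hx)
  have hbΦ : ∀ x ∈ Metric.closedBall c R, ∀ t : Fin N → ℝ, (∀ i, 0 < t i) → ‖Φ x t‖ ≤ b t :=
    fun x hx t ht => hb _ ⟨x, hx, rfl⟩ t ht
  have hmΦ : ∀ x ∈ V, AEStronglyMeasurable (Φ x) μ :=
    fun x hx => aestronglyMeasurable_zetaIntegrand hH (x 0) hx.2
  have hdΦ : ∀ t : Fin N → ℝ, (∀ i, 0 < t i) → ∀ x ∈ V,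
      DifferentiableAt ℂ (fun x => Φ x t) x := by
    intro t ht x hx
    refine (HasFDerivAt.finsetProd fun j _ =>
      (DifferentiableAt.hasFDerivAt ?_)).differentiableAt
    exact DifferentiableAt.cpow (by fun_prop) (by fun_prop)
      (linearForm_mem_slitPlane hH (hx.2 j) j ht)
  have hR2 : 0 < R / 2 := half_pos hR
  have hmain : AnalyticAt ℂ (fun x => ∫ t, Φ x t ∂μ) c := by
    refine analyticAt_of_separately_differentiable hR2 ?_ fun x hx i => ?_
    · have hs : Metric.closedBall c (R / 2) ⊆ Metric.closedBall c R :=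
        Metric.closedBall_subset_closedBall (half_le_self hR.le)
      exact continuousOn_of_dominated (fun x hx => hmΦ x (hRV (hs hx)))
        (fun x hx => hpos.mono fun t ht => hbΦ x (hs hx) t ht) hbi
        (hpos.mono fun t ht x hx =>
          (hdΦ t ht x (hRV (hs hx))).continuousAt.continuousWithinAt)
    · have hu : ∀ z ∈ Metric.closedBall (x i) (R / 2),
          Function.update x i z ∈ Metric.closedBall c R := fun z hz =>
        update_mem_closedBall hR2.le (half_le_self hR.le) (by convert hx using 2; ring) hz
      refine differentiableAt_integral_of_dominated hR2
        (F := fun z t => Φ (Function.update x i z) t)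
        (fun z hz => hmΦ _ (hRV (hu z hz))) (hpos.mono fun t ht z hz => ?_)
        (hpos.mono fun t ht z hz => hbΦ _ (hu z hz) t ht) hbi
      exact ((hdΦ t ht _ (hRV (hu z hz))).comp z
        (hasFDerivAt_update x z).differentiableAt).differentiableWithinAt
  have hcons : AnalyticAt ℂ
      (fun p : ℂ × (Fin n → ℂ) => (Fin.cons p.1 p.2 : Fin (n + 1) → ℂ)) p := by
    refine AnalyticAt.pi fun i => ?_
    refine Fin.cases ?_ (fun j => ?_) i
    · exact analyticAt_fst
    · exact (ContinuousLinearMap.proj (R := ℂ) (φ := fun _ : Fin n => ℂ) j ∘L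
        ContinuousLinearMap.snd ℂ ℂ (Fin n → ℂ)).analyticAt p
  have h := hmain.comp_of_eq hcons rfl
  refine h.congr (Filter.Eventually.of_forall fun q => ?_)
  simp [Φ, μ, zetaIntegral]

/-- Under Hypothesis H the zeta integral converges absolutely for
`Re s > N/(n − Z_M)`, `Re w_j > 0`, uniformly on compact subsets of this region,
and is analytic in `(s,w)` there. -/
theorem zetaIntegral_convergence_and_analytic {N n : ℕ} (hN : 0 < N) (hn : 0 < n)
    (a : Fin N → Fin n → ℂ) (hH : HypH a) :
    (∀ (s : ℂ) (w : Fin n → ℂ), (N : ℝ) / ((n : ℝ) - (ZM a : ℝ)) < s.re →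
      (∀ j, 0 < (w j).re) →
      IntegrableOn (fun t : Fin N → ℝ => ∏ j, (w j + ∑ i, (t i : ℂ) * a i j) ^ (-s))
        {t : Fin N → ℝ | ∀ i, 0 < t i} volume) ∧
    (∀ K : Set (ℂ × (Fin n → ℂ)), IsCompact K →
      K ⊆ {p | (N : ℝ) / ((n : ℝ) - (ZM a : ℝ)) < p.1.re ∧ ∀ j, 0 < (p.2 j).re} →
      ∃ b : (Fin N → ℝ) → ℝ, IntegrableOn b {t : Fin N → ℝ | ∀ i, 0 < t i} volume ∧
        ∀ p ∈ K, ∀ t ∈ {t : Fin N → ℝ | ∀ i, 0 < t i},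
          ‖∏ j, (p.2 j + ∑ i, (t i : ℂ) * a i j) ^ (-p.1)‖ ≤ b t) ∧
    AnalyticOnNhd ℂ (fun p : ℂ × (Fin n → ℂ) => zetaIntegral a p.1 p.2)
      {p | (N : ℝ) / ((n : ℝ) - (ZM a : ℝ)) < p.1.re ∧ ∀ j, 0 < (p.2 j).re} := by
  have hbound := fun K hK hsub => exists_integrable_bound_zetaIntegrand hN hn hH (K := K) hK hsub
  refine ⟨fun s w hs hw => ?_, hbound, fun p hp => analyticAt_zetaIntegral hN hn hH hp⟩
  obtain ⟨b, hbi, hb⟩ := hbound {(s, w)} isCompact_singleton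
    (Set.singleton_subset_iff.2 ⟨hs, hw⟩)
  refine hbi.mono' (aestronglyMeasurable_zetaIntegrand hH s hw) ?_
  filter_upwards [ae_restrict_mem (measurableSet_positiveOrthant N)] with t ht
  exact hb (s, w) rfl t ht
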